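/- Capture-avoiding simultaneous substitution for the untyped lambda calculus satisfies the monad laws, and beta reduction is preserved by substitution in both arguments: for all types X, Y, all f, g : X → ULC Y, all x : X and M, M' : ULC X, one has (1) bind f (Var x) = f x, (2) bind Var M = M, (3) bind g (bind f M) = bind (bind g ∘ f) M; moreover (4) if M β* M' then bind f M β* bind f M', and (5) if f x β* g x for all x : X, then bind f M β* bind g M. -/

import Mathlib

/-- Untyped lambda terms over a type `X` of variables. -/
inductive ULC : Type → Type 1
  | Var : ∀ {X : Type}, X → ULC X
  | Abs : ∀ {X : Type}, ULC (Option X) → ULC X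
  | App : ∀ {X : Type}, ULC X → ULC X → ULC X

/-- Renaming (functoriality in the variables). -/
def rename : ∀ {X Y : Type}, (X → Y) → ULC X → ULC Y
  | _, _, f, .Var x => .Var (f x)
  | _, _, f, .Abs M => .Abs (rename (Option.map f) M)
  | _, _, f, .App M N => .App (rename f M) (rename f N)

/-- Lifting of a substitution under the binder of `Abs`. -/
def lift {X Y : Type} (f : X → ULC Y) : Option X → ULC (Option Y)
  | none => .Var none
  | some x => rename some (f x)

/-- Capture-avoiding simultaneous substitution. -/
def bind : ∀ {X Y : Type}, (X → ULC Y) → ULC X → ULC Y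
  | _, _, f, .Var x => f x
  | _, _, f, .Abs M => .Abs (bind (lift f) M)
  | _, _, f, .App M N => .App (bind f M) (bind f N)

/-- Substitution of the bound variable: `M[∗ := N]`. -/
def subst1 {X : Type} (M : ULC (Option X)) (N : ULC X) : ULC X :=
  bind (fun x => match x with | none => N | some y => .Var y) M

/-- One-step beta reduction, with congruence closure. -/
inductive Beta : ∀ {X : Type}, ULC X → ULC X → Prop
  | beta {X : Type} (M : ULC (Option X)) (N : ULC X) :
      Beta (.App (.Abs M) N) (subst1 M N)
  | absCong {X : Type} {M M' : ULC (Option X)} :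
      Beta M M' → Beta (.Abs M) (.Abs M')
  | appL {X : Type} {M M' N : ULC X} : Beta M M' → Beta (.App M N) (.App M' N)
  | appR {X : Type} {M N N' : ULC X} : Beta N N' → Beta (.App M N) (.App M N')

/-- `β*`: the reflexive–transitive closure of one-step beta reduction. -/
def BetaStar {X : Type} : ULC X → ULC X → Prop :=
  Relation.ReflTransGen Beta

theorem ulc_bind_rename {X : Type} (M : ULC X) : ∀ {Y Z : Type} (r : X → Y) (g : Y → ULC Z),
    _root_.bind g (rename r M) = _root_.bind (fun x => g (r x)) M := by
  induction M with
  | Var x => intros; simp only [rename, _root_.bind]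
  | Abs M ih =>
    intro Y Z r g
    simp only [rename, _root_.bind, ih]
    congr 2
    funext x
    cases x <;> rfl
  | App M N ihM ihN => intros; simp only [rename, _root_.bind, ihM, ihN]

theorem ulc_rename_rename {X : Type} (M : ULC X) : ∀ {Y Z : Type} (r : X → Y) (s : Y → Z),
    rename s (rename r M) = rename (fun x => s (r x)) M := by
  induction M with
  | Var x => intros; simp only [rename]
  | Abs M ih =>
    intro Y Z r s
    simp only [rename, ih]
    congr 2
    funext x
    cases x <;> rfl
  | App M N ihM ihN => intros; simp only [rename, ihM, ihN]

theorem ulc_rename_bind {X : Type} (M : ULC X) : ∀ {Y Z : Type} (f : X → ULC Y) (r : Y → Z),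
    rename r (_root_.bind f M) = _root_.bind (fun x => rename r (f x)) M := by
  induction M with
  | Var x => intros; simp only [_root_.bind]
  | Abs M ih =>
    intro Y Z f r
    simp only [rename, _root_.bind, ih]
    congr 2
    funext x
    cases x with
    | none => rfl
    | some x =>
      simp only [_root_.lift, ulc_rename_rename]
      rfl
  | App M N ihM ihN => intros; simp only [rename, _root_.bind, ihM, ihN]

theorem ulc_bind_var {X : Type} (M : ULC X) : _root_.bind ULC.Var M = M := by
  induction M with
  | Var x => simp only [_root_.bind]
  | @Abs X M ih =>
    have h : _root_.lift (ULC.Var : X → ULC X) = ULC.Var := by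
      funext x
      cases x <;> simp only [_root_.lift, rename]
    simp only [_root_.bind, h, ih]
  | App M N ihM ihN => simp only [_root_.bind, ihM, ihN]

theorem ulc_bind_bind {X : Type} (M : ULC X) : ∀ {Y Z : Type} (f : X → ULC Y) (g : Y → ULC Z),
    _root_.bind g (_root_.bind f M) = _root_.bind (fun x => _root_.bind g (f x)) M := by
  induction M with
  | Var x => intros; simp only [_root_.bind]
  | Abs M ih =>
    intro Y Z f g
    simp only [_root_.bind, ih]
    congr 2
    funext x
    cases x with
    | none => simp only [_root_.lift, _root_.bind]
    | some x => simp only [_root_.lift, ulc_bind_rename, ulc_rename_bind]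
  | App M N ihM ihN => intros; simp only [_root_.bind, ihM, ihN]

theorem ulc_bind_subst1 {X Y : Type} (f : X → ULC Y) (M : ULC (Option X)) (N : ULC X) :
    _root_.bind f (subst1 M N) = subst1 (_root_.bind (_root_.lift f) M) (_root_.bind f N) := by
  simp only [subst1, ulc_bind_bind]
  congr 1
  funext x
  cases x with
  | none => simp only [_root_.lift, _root_.bind]
  | some x => simp only [_root_.lift, _root_.bind, ulc_bind_rename, ulc_bind_var]

theorem ulc_beta_bind {X : Type} {M M' : ULC X} (h : Beta M M') :
    ∀ {Y : Type} (f : X → ULC Y), Beta (_root_.bind f M) (_root_.bind f M') := by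
  induction h with
  | beta M N =>
    intro Y f
    rw [ulc_bind_subst1]
    simp only [_root_.bind]
    exact Beta.beta _ _
  | absCong _ ih => intro Y f; simp only [_root_.bind]; exact Beta.absCong (ih _)
  | appL _ ih => intro Y f; simp only [_root_.bind]; exact Beta.appL (ih _)
  | appR _ ih => intro Y f; simp only [_root_.bind]; exact Beta.appR (ih _)

theorem ulc_betaStar_bind {X Y : Type} (f : X → ULC Y) {M M' : ULC X} (h : BetaStar M M') :
    BetaStar (_root_.bind f M) (_root_.bind f M') :=
  Relation.ReflTransGen.lift (_root_.bind f) (fun _ _ h => ulc_beta_bind h f) _ _ h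

theorem ulc_rename_eq_bind {X Y : Type} (r : X → Y) (M : ULC X) :
    rename r M = _root_.bind (fun x => ULC.Var (r x)) M := by
  rw [← ulc_bind_rename M r ULC.Var, ulc_bind_var]

theorem ulc_betaStar_bind_right {X : Type} (M : ULC X) : ∀ {Y : Type} (f g : X → ULC Y),
    (∀ x, BetaStar (f x) (g x)) → BetaStar (_root_.bind f M) (_root_.bind g M) := by
  induction M with
  | Var x => intro Y f g h; simpa only [_root_.bind] using h x
  | Abs M ih =>
    intro Y f g h
    simp only [_root_.bind]
    refine Relation.ReflTransGen.lift ULC.Abs (fun _ _ h => Beta.absCong h) _ _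
      (ih (_root_.lift f) (_root_.lift g) ?_)
    intro x
    cases x with
    | none => exact Relation.ReflTransGen.refl
    | some x =>
      simp only [_root_.lift, ulc_rename_eq_bind]
      exact ulc_betaStar_bind _ (h x)
  | App M N ihM ihN =>
    intro Y f g h
    simp only [_root_.bind]
    exact Relation.ReflTransGen.trans
      (Relation.ReflTransGen.lift (fun P => ULC.App P _) (fun _ _ h => Beta.appL h) _ _ (ihM f g h))
      (Relation.ReflTransGen.lift (fun P => ULC.App _ P) (fun _ _ h => Beta.appR h) _ _ (ihN f g h))

theorem ulc_bind_monad_laws_and_beta_substitutivity :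
    (∀ (X Y : Type) (f : X → ULC Y) (x : X), bind f (ULC.Var x) = f x) ∧
    (∀ (X : Type) (M : ULC X), bind ULC.Var M = M) ∧
    (∀ (X Y Z : Type) (f : X → ULC Y) (g : Y → ULC Z) (M : ULC X),
        bind g (bind f M) = bind (bind g ∘ f) M) ∧
    (∀ (X Y : Type) (f : X → ULC Y) (M M' : ULC X),
        BetaStar M M' → BetaStar (bind f M) (bind f M')) ∧
    (∀ (X Y : Type) (f g : X → ULC Y) (M : ULC X),
        (∀ x : X, BetaStar (f x) (g x)) → BetaStar (bind f M) (bind g M)) := by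
  exact ⟨fun _ _ f x => by simp only [_root_.bind], fun _ M => ulc_bind_var M,
    fun _ _ _ f g M => ulc_bind_bind M f g, fun _ _ f _ _ h => ulc_betaStar_bind f h,
    fun _ _ f g M h => ulc_betaStar_bind_right M f g h⟩
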